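/- arXiv:1406.7559 — 3 statements merged into one kernel-verified Lean document; each statement's English description precedes it below -/
import Mathlib

section
/- Let R be a commutative Noetherian ring of finite Krull dimension such that for every prime ideal 𝔭 of R the localization R_𝔭 is a regular local ring. Then every finitely generated R-module M admits a finite resolution 0 → P_m → ⋯ → P_0 → M → 0 by finitely generated projective R-modules. -/
universe u v

/-- `FGProjDimLE S n M` means that the `S`-module `M` admits a resolution
`0 → P_n → ⋯ → P_0 → M → 0` of length `n` in which every `P_i` is a finitely
generated projective `S`-module. -/
def FGProjDimLE (S : Type v) [Ring S] : ℕ → ∀ (M : Type u) [AddCommGroup M] [Module S M], Prop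
  | 0, M, _, _ => Module.Finite S M ∧ Module.Projective S M
  | n + 1, M, _, _ =>
      ∃ (P : Type u) (_ : AddCommGroup P) (_ : Module S P) (f : P →ₗ[S] M),
        Module.Finite S P ∧ Module.Projective S P ∧ Function.Surjective f ∧
          FGProjDimLE S n (LinearMap.ker f)

/-- A commutative ring is a regular local ring if it is Noetherian, local, and its maximal
ideal can be generated by `d` elements, where `d` is the Krull dimension of the ring. -/
def IsRegularLocal (A : Type u) [CommRing A] : Prop :=
  IsNoetherianRing A ∧ IsLocalRing A ∧
    ∃ (s : Finset A) (_ : IsLocalRing A),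
      Ideal.span (s : Set A) = IsLocalRing.maximalIdeal A ∧
        (s.card : WithBot ℕ∞) = ringKrullDim A

open CategoryTheory IsLocalRing

lemma pd_ker {B : Type u} [CommRing B] {K P M : Type u} [AddCommGroup K] [AddCommGroup P]
    [AddCommGroup M] [Module B K] [Module B P] [Module B M] (i : K →ₗ[B] P) (g : P →ₗ[B] M)
    (hi : Function.Injective i) (hex : Function.Exact i g) (hg : Function.Surjective g)
    (hP : Module.Projective B P) (n : ℕ) :
    HasProjectiveDimensionLE (ModuleCat.of B M) (n + 1) ↔
    HasProjectiveDimensionLE (ModuleCat.of B K) n := by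
  let S : ShortComplex (ModuleCat.{u} B) :=
    ShortComplex.mk (ModuleCat.ofHom i) (ModuleCat.ofHom g)
      (by ext y; exact hex.apply_apply_eq_zero y)
  have hS' : S.ShortExact := ModuleCat.shortComplex_shortExact S hex hi hg
  exact (hS'.hasProjectiveDimensionLT_X₃_iff n ((IsProjective.iff_projective _).mp hP))

lemma pd_of_quot {A : Type u} [CommRing A] [IsLocalRing A] [IsNoetherianRing A] (x : A)
    (hx : x ∈ maximalIdeal A) (hreg : IsSMulRegular A x) (n : ℕ) :
    ∀ (M : Type u) [AddCommGroup M] [Module A M] [Module.Finite A M] (_ : IsSMulRegular M x)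
    (_ : HasProjectiveDimensionLE (ModuleCat.of (A ⧸ Ideal.span {x}) (QuotSMulTop x M)) n),
    HasProjectiveDimensionLE (ModuleCat.of A M) n := by
  have hlt : Ideal.span {x} ≤ maximalIdeal A := by simpa [Ideal.span_le] using hx
  have : Nontrivial (A ⧸ Ideal.span {x}) := Ideal.Quotient.nontrivial_iff.mpr
    (fun h => (maximalIdeal.isMaximal A).ne_top (top_le_iff.mp (h ▸ hlt)))
  have : IsLocalRing (A ⧸ Ideal.span {x}) :=
    .of_surjective' (Ideal.Quotient.mk _) Ideal.Quotient.mk_surjective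
  induction n with
  | zero =>
    intro M _ _ _ hM h
    rw [← projective_iff_hasProjectiveDimensionLE_zero, ← IsProjective.iff_projective] at h ⊢
    have := Module.Finite.of_restrictScalars_finite A (A ⧸ Ideal.span {x}) (QuotSMulTop x M)
    have h1 : Module.Projective (A ⧸ Ideal.span {x}) (QuotSMulTop x M) := h
    have h2 : Module.Free (A ⧸ Ideal.span {x}) (QuotSMulTop x M) :=
      Module.free_of_flat_of_isLocalRing
    have : Module.FinitePresentation A M := Module.finitePresentation_of_finite A M
    have : Module.Free A M := (Module.free_quotSMulTop_iff_free A M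
      (IsLocalRing.maximalIdeal_le_jacobson _ hx) hM).mp h2
    exact Module.Projective.of_free
  | succ n ih =>
    intro M _ _ _ hM h
    obtain ⟨P, _, _, _, _, f, surjf⟩ := Module.exists_finite_presentation A M
    have hP : IsSMulRegular P x := by
      have := (hreg.lTensor P)
      exact ((TensorProduct.rid A P).isSMulRegular_congr x).mp this
    refine (pd_ker (LinearMap.ker f).subtype f Subtype.val_injective
      (LinearMap.exact_subtype_ker_map f) surjf inferInstance n).mpr ?_
    refine ih (LinearMap.ker f) (hP.submodule _ _) ?_
    let i := (QuotSMulTop.map x (LinearMap.ker f).subtype).extendScalarsOfSurjective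
      (Ideal.Quotient.mk_surjective (I := Ideal.span {x}))
    let g := (QuotSMulTop.map x f).extendScalarsOfSurjective
      (Ideal.Quotient.mk_surjective (I := Ideal.span {x}))
    have hg : Function.Surjective g := QuotSMulTop.map_surjective x surjf
    have hex : Function.Exact i g := QuotSMulTop.map_exact x (LinearMap.exact_subtype_ker_map f) surjf
    have hi : Function.Injective i := by
      have h0 : Function.Exact (0 : PUnit.{1} →ₗ[A] LinearMap.ker f) (LinearMap.ker f).subtype := by
        rw [LinearMap.exact_zero_iff_injective]
        exact Subtype.val_injective
      have := QuotSMulTop.map_first_exact_on_four_term_exact_of_isSMulRegular_last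
        h0 (LinearMap.exact_subtype_ker_map f) hM
      rw [map_zero, LinearMap.exact_zero_iff_injective] at this
      exact this
    exact (pd_ker i g hi hex hg Module.Projective.of_free n).mp h

def RegDim (A : Type u) [CommRing A] [IsLocalRing A] (d : ℕ) : Prop :=
  (∃ v : Fin d → A, Ideal.span (Set.range v) = maximalIdeal A) ∧ ringKrullDim A = d

lemma regDim_quot {A : Type u} [CommRing A] [IsLocalRing A] [IsNoetherianRing A] (d : ℕ)
    (h : RegDim A (d + 1)) (x : A) (hx : x ∈ maximalIdeal A) (hx2 : x ∉ (maximalIdeal A) ^ 2)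
    [IsLocalRing (A ⧸ Ideal.span {x})] : RegDim (A ⧸ Ideal.span {x}) d := by
  obtain ⟨⟨v, hv⟩, hd⟩ := h
  obtain ⟨a, ha⟩ := (Ideal.mem_span_range_iff_exists_fun).mp (hv ▸ hx)
  have hvm : ∀ i, v i ∈ maximalIdeal A := fun i => hv ▸ Ideal.subset_span ⟨i, rfl⟩
  obtain ⟨i, hi⟩ : ∃ i, IsUnit (a i) := by
    by_contra! hcon
    apply hx2
    rw [← ha, pow_two]
    exact Ideal.sum_mem _ fun i _ => Ideal.mul_mem_mul (by simpa using hcon i) (hvm i)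
  let q := Ideal.Quotient.mk (Ideal.span {x})
  have hq : q x = 0 := Ideal.Quotient.eq_zero_iff_mem.mpr (Ideal.mem_span_singleton_self x)
  have hgen : Ideal.span (Set.range fun j => q (v (i.succAbove j))) =
      maximalIdeal (A ⧸ Ideal.span {x}) := by
    have hmap : (maximalIdeal A).map q = maximalIdeal (A ⧸ Ideal.span {x}) := by
      have : IsLocalHom q := IsLocalHom.of_surjective q Ideal.Quotient.mk_surjective
      rw [← IsLocalRing.maximalIdeal_comap q,
        Ideal.map_comap_of_surjective q Ideal.Quotient.mk_surjective]
    rw [← hmap]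
    apply le_antisymm
    · rw [Ideal.span_le]
      rintro _ ⟨j, rfl⟩
      exact Ideal.mem_map_of_mem q (hvm _)
    · rw [← hv, Ideal.map_span, Ideal.span_le]
      rintro _ ⟨_, ⟨k, rfl⟩, rfl⟩
      have hmem : ∀ j, q (v (i.succAbove j)) ∈
          Ideal.span (Set.range fun j => q (v (i.succAbove j))) :=
        fun j => Ideal.subset_span ⟨j, rfl⟩
      rcases Fin.eq_self_or_eq_succAbove i k with rfl | ⟨j, rfl⟩
      · have hu : IsUnit (q (a k)) := hi.map q
        refine (Ideal.unit_mul_mem_iff_mem _ hu).mp ?_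
        have := congrArg q ha
        rw [hq, Fin.sum_univ_succAbove _ k] at this
        simp only [map_add, map_mul, map_sum] at this
        rw [eq_neg_of_add_eq_zero_left this]
        exact neg_mem (Ideal.sum_mem _ fun j _ => Ideal.mul_mem_left _ _ (hmem j))
      · exact hmem j
  refine ⟨⟨_, hgen⟩, le_antisymm ?_ ?_⟩
  · refine (ringKrullDim_le_spanFinrank_maximalIdeal _).trans ?_
    rw [← hgen]
    have h1 := Submodule.spanFinrank_span_le_ncard_of_finite (R := A ⧸ Ideal.span {x})
      (Set.finite_range fun j => q (v (i.succAbove j)))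
    have h2 : (Set.range fun j => q (v (i.succAbove j))).ncard ≤ d := by
      rw [← Set.image_univ]
      refine (Set.ncard_image_le).trans ?_
      simp [Set.ncard_univ]
    exact_mod_cast h1.trans h2
  · have := Ideal.height_le_ringKrullDim_quotient_add_one hx
    rw [IsLocalRing.maximalIdeal_height_eq_ringKrullDim, hd] at this
    push_cast at this
    generalize ringKrullDim (A ⧸ Ideal.span {x}) = e at this
    exact (ENat.WithBot.add_le_add_one_right_iff).mp this

lemma regDim_domain (d : ℕ) : ∀ (A : Type u) [CommRing A] [IsLocalRing A] [IsNoetherianRing A]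
    (_ : RegDim A d), IsDomain A ∧ ∀ d', d = d' + 1 →
      ∃ x ∈ maximalIdeal A, x ≠ 0 ∧ ∃ _ : IsLocalRing (A ⧸ Ideal.span {x}),
        RegDim (A ⧸ Ideal.span {x}) d' := by
  induction d with
  | zero =>
    intro A _ _ _ h
    refine ⟨?_, by simp⟩
    obtain ⟨⟨v, hv⟩, hd⟩ := h
    rw [Set.range_eq_empty, Ideal.span_empty] at hv
    exact ((isField_iff_maximalIdeal_eq).mpr hv.symm).isDomain
  | succ d ih =>
    intro A _ _ _ h
    have hfin := minimalPrimes.finite_of_isNoetherianRing A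
    have hnm : maximalIdeal A ∉ minimalPrimes A := by
      intro hm
      have : (maximalIdeal A).height = 0 := Ideal.height_eq_zero_iff.mpr hm
      have h2 := IsLocalRing.maximalIdeal_height_eq_ringKrullDim (R := A)
      rw [this, h.2] at h2
      norm_cast at h2
    have h2 : ¬ maximalIdeal A ≤ (maximalIdeal A) ^ 2 := by
      intro hle
      have hb : maximalIdeal A = ⊥ := Submodule.eq_bot_of_le_smul_of_le_jacobson_bot
        (maximalIdeal A) (maximalIdeal A) (IsNoetherian.noetherian _)
        (by rwa [smul_eq_mul, ← pow_two]) (maximalIdeal_le_jacobson _)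
      have := ringKrullDim_eq_zero_of_isField (isField_iff_maximalIdeal_eq.mpr hb)
      rw [h.2] at this
      norm_cast at this
    have hav := (Ideal.subset_union_prime (s := insert (maximalIdeal A ^ 2) hfin.toFinset)
      (f := fun I => I) (maximalIdeal A ^ 2) (maximalIdeal A ^ 2) (I := maximalIdeal A) (by
        intro I hI h1 _
        simp only [Finset.mem_insert, h1, Set.Finite.mem_toFinset, false_or] at hI
        exact hI.1.1)).not.mpr (by
        rintro ⟨I, hI, hle⟩
        simp only [Finset.mem_insert, Set.Finite.mem_toFinset] at hI
        rcases hI with rfl | hI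
        · exact h2 hle
        · have := hI.1.1
          exact hnm ((IsLocalRing.eq_maximalIdeal
            ((maximalIdeal.isMaximal A).eq_of_le this.ne_top hle ▸ maximalIdeal.isMaximal A)) ▸ hI))
    obtain ⟨x, hx, hx'⟩ := Set.not_subset.mp hav
    simp only [Finset.coe_insert, Set.Finite.coe_toFinset, Set.mem_insert_iff, Set.iUnion_iUnion_eq_or_left,
      Set.mem_union, Set.mem_iUnion, not_or, not_exists, SetLike.mem_coe] at hx'
    obtain ⟨hx2, hxm⟩ := hx'
    have hlt : Ideal.span {x} ≤ maximalIdeal A := by simpa [Ideal.span_le] using hx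
    have : Nontrivial (A ⧸ Ideal.span {x}) := Ideal.Quotient.nontrivial_iff.mpr
      (fun h => (maximalIdeal.isMaximal A).ne_top (top_le_iff.mp (h ▸ hlt)))
    have : IsLocalRing (A ⧸ Ideal.span {x}) :=
      .of_surjective' (Ideal.Quotient.mk _) Ideal.Quotient.mk_surjective
    have hr := regDim_quot d h x hx hx2
    have hpr : (Ideal.span {x}).IsPrime := (Ideal.Quotient.isDomain_iff_prime _).mp (ih _ hr).1
    obtain ⟨p, hp, hple⟩ := Ideal.exists_minimalPrimes_le (bot_le : (⊥ : Ideal A) ≤ Ideal.span {x})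
    have hxp := hxm p hp
    have : p.IsPrime := hp.1.1
    have hpb : p = ⊥ := by
      refine Submodule.eq_bot_of_le_smul_of_le_jacobson_bot (maximalIdeal A) p
        (IsNoetherian.noetherian _) ?_ (maximalIdeal_le_jacobson _)
      intro y hy
      obtain ⟨a, rfl⟩ := Ideal.mem_span_singleton'.mp (hple hy)
      have := (this.mem_or_mem hy).resolve_right hxp
      rw [mul_comm]
      exact Ideal.mul_mem_mul hx this
    subst hpb
    refine ⟨(IsDomain.of_bot_isPrime A), ?_⟩
    rintro d' hd'
    obtain rfl : d = d' := by omega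
    exact ⟨x, hx, fun h0 => hxp (by simp [h0]), ‹_›, hr⟩

lemma regDim_pd (d : ℕ) : ∀ (A : Type u) [CommRing A] [IsLocalRing A] [IsNoetherianRing A]
    (_ : RegDim A d) (M : Type u) [AddCommGroup M] [Module A M] [Module.Finite A M],
    HasProjectiveDimensionLE (ModuleCat.of A M) d := by
  induction d with
  | zero =>
    intro A _ _ _ h M _ _ _
    obtain ⟨⟨v, hv⟩, hd⟩ := h
    rw [Set.range_eq_empty, Ideal.span_empty] at hv
    let : Field A := ((isField_iff_maximalIdeal_eq).mpr hv.symm).toField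
    rw [← projective_iff_hasProjectiveDimensionLE_zero, ← IsProjective.iff_projective]
    exact (Module.Projective.of_free : Module.Projective A M)
  | succ d ih =>
    intro A _ _ _ h M _ _ _
    obtain ⟨hdom, h1⟩ := regDim_domain _ A h
    obtain ⟨x, hx, hx0, _, hr⟩ := h1 d rfl
    have hreg : IsSMulRegular A x := (IsRegular.of_ne_zero hx0).left
    obtain ⟨P, _, _, _, _, f, surjf⟩ := Module.exists_finite_presentation A M
    have hP : IsSMulRegular P x :=
      ((TensorProduct.rid A P).isSMulRegular_congr x).mp (hreg.lTensor P)
    refine (pd_ker (LinearMap.ker f).subtype f Subtype.val_injective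
      (LinearMap.exact_subtype_ker_map f) surjf inferInstance d).mpr ?_
    have := Module.Finite.of_restrictScalars_finite A (A ⧸ Ideal.span {x})
      (QuotSMulTop x (LinearMap.ker f))
    exact pd_of_quot x hx hreg d _ (hP.submodule _ _) (ih _ hr _)

lemma fg_of_pd {R : Type u} [CommRing R] [IsNoetherianRing R] (n : ℕ) :
    ∀ (M : Type u) [AddCommGroup M] [Module R M] [Module.Finite R M]
    (_ : HasProjectiveDimensionLE (ModuleCat.of R M) n), FGProjDimLE R n M := by
  induction n with
  | zero =>
    intro M _ _ _ h
    rw [← projective_iff_hasProjectiveDimensionLE_zero, ← IsProjective.iff_projective] at h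
    exact ⟨inferInstance, h⟩
  | succ n ih =>
    intro M _ _ _ h
    obtain ⟨P, _, _, _, _, f, surjf⟩ := Module.exists_finite_presentation R M
    exact ⟨P, _, _, f, inferInstance, inferInstance, surjf, ih _
      ((pd_ker (LinearMap.ker f).subtype f Subtype.val_injective
      (LinearMap.exact_subtype_ker_map f) surjf inferInstance n).mp h)⟩

lemma regDim_of_isRegularLocal {A : Type u} [CommRing A] [IsLocalRing A] (h : IsRegularLocal A) :
    ∃ d, RegDim A d := by
  obtain ⟨_, _, s, _, hs, hd⟩ := h
  refine ⟨s.card, ⟨fun i => (s.equivFin.symm i : A), ?_⟩, hd.symm⟩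
  rw [← hs]
  congr 1
  ext y
  constructor
  · rintro ⟨i, rfl⟩
    exact (s.equivFin.symm i).2
  · intro hy
    exact ⟨s.equivFin ⟨y, hy⟩, by simp⟩

/-- Let `R` be a commutative Noetherian ring of finite Krull dimension such that `R_𝔭` is a
regular local ring for every prime `𝔭`. Then every finitely generated `R`-module `M` admits
a finite resolution `0 → P_m → ⋯ → P_0 → M → 0` by finitely generated projective
`R`-modules. -/
theorem exists_fg_projective_resolution_of_regular
    (R : Type u) [CommRing R] [IsNoetherianRing R]
    (hdim : ringKrullDim R ≠ ⊤)
    (hreg : ∀ (𝔭 : Ideal R) [𝔭.IsPrime], IsRegularLocal (Localization.AtPrime 𝔭))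
    (M : Type u) [AddCommGroup M] [Module R M] [Module.Finite R M] :
    ∃ m : ℕ, FGProjDimLE R m M := by
  obtain ⟨n, hn⟩ : ∃ n : ℕ, ringKrullDim R ≤ n := by
    generalize ringKrullDim R = e at hdim
    induction e with
    | bot => exact ⟨0, bot_le⟩
    | coe e =>
      induction e with
      | top => exact absurd rfl hdim
      | coe k => exact ⟨k, le_rfl⟩
  refine ⟨n, fg_of_pd n M ?_⟩
  rw [ModuleCat.hasProjectiveDimensionLE_iff_forall_maximalSpectrum n (ModuleCat.of R M)]
  intro m
  have hmp : m.1.IsPrime := m.2.isPrime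
  have : IsNoetherianRing (Localization.AtPrime m.1) := (hreg m.1).1
  obtain ⟨d, hd⟩ := regDim_of_isRegularLocal (hreg m.1)
  have hle : d ≤ n := by
    have h1 := IsLocalization.AtPrime.ringKrullDim_eq_height m.1 (Localization.AtPrime m.1)
    have h2 := (Ideal.height_le_ringKrullDim_of_isPrime (I := m.1)).trans hn
    rw [← h1, hd.2] at h2
    exact_mod_cast h2
  have hil := ModuleCat.localizedModule_isLocalizedModule (ModuleCat.of R M) m.1.primeCompl
  have hfin : Module.Finite (Localization.AtPrime m.1)
      ((ModuleCat.of R M).localizedModule m.1.primeCompl) :=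
    Module.Finite.of_isLocalizedModule m.1.primeCompl
      ((ModuleCat.of R M).localizedModuleMkLinearMap m.1.primeCompl)
  have := regDim_pd d (Localization.AtPrime m.1) hd
    ((ModuleCat.of R M).localizedModule m.1.primeCompl)
  exact hasProjectiveDimensionLT_of_ge _ (d + 1) (n + 1) (by omega)
end

section
/- Let k be a field, let A = k[T, ε]/((T² − 1)ε, ε²) be the quotient of the polynomial ring over k in two variables T, ε by the ideal generated by (T² − 1)ε and ε², and let B = A_T be the localization of A at the multiplicative set of powers of the image of T. Then there exists a nonzero A-module homomorphism B → A. -/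
universe u

set_option synthInstance.maxHeartbeats 1000000
set_option maxHeartbeats 1000000

noncomputable section

namespace Statement15

variable (k : Type u) [Field k]

/-- The ring `A = k[T, ε] / ((T² − 1)ε, ε²)`, with `T = X 0` and `ε = X 1`. -/
abbrev A : Type u :=
  MvPolynomial (Fin 2) k ⧸
    Ideal.span ({(MvPolynomial.X 0 ^ 2 - 1) * MvPolynomial.X 1, MvPolynomial.X 1 ^ 2} :
      Set (MvPolynomial (Fin 2) k))

/-- The localization `B = A_T = A[T⁻¹]` of `A` away from (the image of) `T`. -/
abbrev B : Type u :=
  Localization.Away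
    (Ideal.Quotient.mk
      (Ideal.span ({(MvPolynomial.X 0 ^ 2 - 1) * MvPolynomial.X 1, MvPolynomial.X 1 ^ 2} :
        Set (MvPolynomial (Fin 2) k)))
      (MvPolynomial.X 0))

/-- Let `k` be a field, `A = k[T, ε]/((T² − 1)ε, ε²)` and `B = A_T`. Then there exists a
nonzero `A`-module homomorphism `B → A`. -/
theorem exists_nonzero_linearMap : ∃ f : B k →ₗ[A k] A k, f ≠ 0 := by
  let J : Ideal (MvPolynomial (Fin 2) k) :=
    Ideal.span ({(MvPolynomial.X 0 ^ 2 - 1) * MvPolynomial.X 1, MvPolynomial.X 1 ^ 2} :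
      Set (MvPolynomial (Fin 2) k))
  let t : A k := Ideal.Quotient.mk J (MvPolynomial.X 0)
  let e : A k := Ideal.Quotient.mk J (MvPolynomial.X 1)
  have hte : t * t * e = e := by
    have h : Ideal.Quotient.mk J ((MvPolynomial.X 0 ^ 2 - 1) * MvPolynomial.X 1) = 0 :=
      Ideal.Quotient.eq_zero_iff_mem.2 (Ideal.subset_span (by simp))
    rw [map_mul, map_sub, map_pow, map_one] at h
    change (t ^ 2 - 1) * e = 0 at h
    linear_combination h
  have he : e ≠ 0 := by
    intro h
    have h1 : (MvPolynomial.X 1 : MvPolynomial (Fin 2) k) ∈ J :=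
      Ideal.Quotient.eq_zero_iff_mem.1 h
    let φ : MvPolynomial (Fin 2) k →ₐ[k] DualNumber k :=
      MvPolynomial.aeval ![1, DualNumber.eps]
    have hJ : J ≤ RingHom.ker φ := by
      refine Ideal.span_le.2 ?_
      rintro x (rfl | rfl)
      · simp [φ, RingHom.mem_ker]
      · simp [φ, RingHom.mem_ker, pow_two]
    have h2 : φ (MvPolynomial.X 1) = 0 := hJ h1
    have h3 := congrArg TrivSqZeroExt.snd h2
    simp [φ] at h3
  let I : Submodule (A k) (A k) := Submodule.span (A k) {e}
  have hI : ∀ x ∈ I, t * t * x = x := by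
    intro x hx
    obtain ⟨a, rfl⟩ := Submodule.mem_span_singleton.1 hx
    rw [smul_eq_mul]
    linear_combination a * hte
  have hu : IsUnit (algebraMap (A k) (Module.End (A k) I) t) := by
    have h5 : algebraMap (A k) (Module.End (A k) I) t * algebraMap (A k) (Module.End (A k) I) t
        = 1 := by
      rw [← map_mul]
      ext x
      exact hI x x.2
    exact ⟨⟨_, _, h5, h5⟩, rfl⟩
  have hS : ∀ x : Submonoid.powers t, IsUnit (algebraMap (A k) (Module.End (A k) I) x) := by
    rintro ⟨_, n, rfl⟩
    simpa only [map_pow] using hu.pow n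
  let g : A k →ₗ[A k] I :=
    LinearMap.toSpanSingleton (A k) I ⟨e, Submodule.mem_span_singleton_self e⟩
  let l : A k →ₗ[A k] B k := Algebra.linearMap (A k) (B k)
  have : IsLocalizedModule (Submonoid.powers t) l :=
    inferInstanceAs (IsLocalizedModule (Submonoid.powers t)
      (Algebra.linearMap (A k) (Localization (Submonoid.powers t))))
  refine ⟨I.subtype ∘ₗ IsLocalizedModule.lift (Submonoid.powers t) l g hS, fun h => he ?_⟩
  have h4 := LinearMap.congr_fun h (l 1)
  rw [LinearMap.comp_apply, IsLocalizedModule.lift_apply] at h4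
  simpa [g] using h4

end Statement15
end
end

section
/- Let k be a field, let A = k[S, T]/(ST) be the quotient of the polynomial ring over k in two variables S, T by the ideal generated by ST, and let B = A_{S+1} be the localization of A at the multiplicative set of powers of the image of S + 1. Then there exists a nonzero A-module homomorphism B → A. -/
universe u

set_option synthInstance.maxHeartbeats 1000000
set_option maxHeartbeats 1000000

noncomputable section

namespace Statement16

variable (k : Type u) [Field k]

/-- The ring `A = k[S, T] / (ST)`, with `S = X 0` and `T = X 1`. -/
abbrev A : Type u :=
  MvPolynomial (Fin 2) k ⧸
    Ideal.span ({MvPolynomial.X 0 * MvPolynomial.X 1} : Set (MvPolynomial (Fin 2) k))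

/-- The localization `B = A_{S+1} = A[(S+1)⁻¹]` of `A` away from (the image of) `S + 1`. -/
abbrev B : Type u :=
  Localization.Away
    (Ideal.Quotient.mk
      (Ideal.span ({MvPolynomial.X 0 * MvPolynomial.X 1} : Set (MvPolynomial (Fin 2) k)))
      (MvPolynomial.X 0 + 1))

/-- Let `k` be a field, `A = k[S, T]/(ST)` and `B = A_{S+1}`. Then there exists a nonzero
`A`-module homomorphism `B → A`. -/
theorem exists_nonzero_linearMap : ∃ f : B k →ₗ[A k] A k, f ≠ 0 := by
  classical
  let mk := Ideal.Quotient.mk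
      (Ideal.span ({MvPolynomial.X 0 * MvPolynomial.X 1} : Set (MvPolynomial (Fin 2) k)))
  let s : A k := mk (MvPolynomial.X 0)
  let t : A k := mk (MvPolynomial.X 1)
  have hst : s * t = 0 := by
    change mk _ * mk _ = 0
    rw [← map_mul]
    exact Ideal.Quotient.eq_zero_iff_mem.mpr (Ideal.subset_span rfl)
  have ht : t ≠ 0 := by
    intro h
    have h1 := Ideal.mem_span_singleton.mp (Ideal.Quotient.eq_zero_iff_mem.mp h)
    obtain ⟨c, hc⟩ := h1
    have := congrArg (MvPolynomial.eval (![0, 1] : Fin 2 → k)) hc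
    simp at this
  let g : A k →ₗ[A k] (Ideal.span {t} : Ideal (A k)) :=
    LinearMap.toSpanSingleton (A k) _ ⟨t, Ideal.mem_span_singleton_self t⟩
  have hs1 : mk (MvPolynomial.X 0 + 1) = s + 1 := by simp [s]
  have hu : ∀ x : Submonoid.powers (mk (MvPolynomial.X 0 + 1)),
      IsUnit (algebraMap (A k) (Module.End (A k) (Ideal.span {t} : Ideal (A k))) x) := by
    rintro ⟨_, n, rfl⟩
    have h1 : algebraMap (A k) (Module.End (A k) (Ideal.span {t} : Ideal (A k)))
        (mk (MvPolynomial.X 0 + 1)) = 1 := by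
      rw [hs1]
      ext ⟨y, hy⟩
      obtain ⟨c, rfl⟩ := Ideal.mem_span_singleton.mp hy
      change (s + 1) * (t * c) = t * c
      linear_combination c * hst
    simp only [map_pow, h1, one_pow, isUnit_one]
  let F : B k →ₗ[A k] (Ideal.span {t} : Ideal (A k)) :=
    IsLocalizedModule.lift (Submonoid.powers (mk (MvPolynomial.X 0 + 1)))
      (Algebra.linearMap (A k) (B k)) g hu
  refine ⟨(Submodule.subtype _).comp F, fun h => ht ?_⟩
  have h2 : F (Algebra.linearMap (A k) (B k) 1) = g 1 :=
    IsLocalizedModule.lift_apply _ _ _ _ _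
  have h3 := LinearMap.congr_fun h (Algebra.linearMap (A k) (B k) 1)
  rw [LinearMap.comp_apply, h2] at h3
  simpa [g] using h3

end Statement16
end
end
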